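/- From static to dynamic Schrödinger bridges: let Ω be a standard Borel space, e : Ω → ℝ^n × ℝ^n measurable, R a probability measure on Ω, and κ a Markov kernel from ℝ^n × ℝ^n to Ω disintegrating R over e, i.e. R(A ∩ e⁻¹(B)) = ∫_B κ(u)(A) d(e∗R)(u) for all measurable A ⊆ Ω and Borel B ⊆ ℝ^n × ℝ^n, and κ(u)(e⁻¹{u}) = 1 for e∗R-a.e. u. Suppose π̂ ∈ Π(ρ0, ρT) attains the infimum of KL(·‖e∗R) over Π(ρ0, ρT) and this infimum is finite. Define P̂ on Ω by P̂(A) := ∫ κ(u)(A) dπ̂(u). Then e∗P̂ = π̂, KL(P̂‖R) = KL(π̂‖e∗R), and for every probability measure P on Ω with e∗P ∈ Π(ρ0, ρT) one has KL(P̂‖R) ≤ KL(P‖R); thus P̂ attains the infimum of KL(·‖R) over all P with e∗P ∈ Π(ρ0, ρT). -/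

import Mathlib

open MeasureTheory Classical

/-- Kullback–Leibler divergence: `∫ log (dμ/dν) dμ` if `μ ≪ ν` (and the
integral is well defined), `+∞` otherwise. -/
noncomputable def KL {α : Type*} [MeasurableSpace α] (μ ν : Measure α) : EReal :=
  if μ ≪ ν ∧ Integrable (fun x => Real.log ((μ.rnDeriv ν x).toReal)) μ
  then ((∫ x, Real.log ((μ.rnDeriv ν x).toReal) ∂μ : ℝ) : EReal) else ⊤

/-- The set `Π(ρ0, ρT)` of couplings of `ρ0` and `ρT`. -/
def Coupling {n : ℕ} (ρ0 ρT : Measure (Fin n → ℝ)) :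
    Set (Measure ((Fin n → ℝ) × (Fin n → ℝ))) :=
  {π | IsProbabilityMeasure π ∧ π.map Prod.fst = ρ0 ∧ π.map Prod.snd = ρT}

open ProbabilityTheory InformationTheory in
/-- On probability measures, `KL` agrees with Mathlib's `klDiv`. -/
lemma KL_eq_klDiv {α : Type*} [MeasurableSpace α] (μ ν : Measure α)
    [IsProbabilityMeasure μ] [IsProbabilityMeasure ν] :
    KL μ ν = (klDiv μ ν : EReal) := by
  by_cases h : μ ≪ ν ∧ Integrable (llr μ ν) μ
  · have h0 := integral_llr_add_sub_measure_univ_nonneg h.1 h.2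
    simp only [probReal_univ, add_sub_cancel_right] at h0
    rw [klDiv_of_ac_of_integrable h.1 h.2]
    simp only [probReal_univ, add_sub_cancel_right]
    rw [EReal.coe_ennreal_ofReal, max_eq_left h0]
    exact if_pos h
  · have htop : klDiv μ ν = ⊤ := by
      by_contra h'
      exact h (klDiv_ne_top_iff.mp h')
    rw [htop, EReal.coe_ennreal_top]
    exact if_neg h

/-- A mixture of probability measures `κ u`, each carried by the fiber of `e` over `u`, is mapped
by `e` to the mixing measure. -/
lemma map_bind_of_ae_fiber {α Ω : Type*} [MeasurableSpace α] [MeasurableSingletonClass α]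
    [MeasurableSpace Ω] {e : Ω → α} (he : Measurable e) (κ : ProbabilityTheory.Kernel α Ω)
    [ProbabilityTheory.IsMarkovKernel κ] {π : Measure α}
    (h : ∀ᵐ u ∂π, κ u (e ⁻¹' {u}) = 1) :
    (π.bind κ).map e = π := by
  ext B hB
  rw [Measure.map_apply he hB, Measure.bind_apply (he hB) κ.aemeasurable,
    ← lintegral_indicator_one hB]
  refine lintegral_congr_ae ?_
  filter_upwards [h] with u hu
  by_cases huB : u ∈ B
  · rw [Set.indicator_of_mem huB, Pi.one_apply]
    refine le_antisymm prob_le_one (hu ▸ measure_mono ?_)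
    exact Set.preimage_mono (Set.singleton_subset_iff.mpr huB)
  · rw [Set.indicator_of_notMem huB]
    refine measure_mono_null (t := (e ⁻¹' {u})ᶜ) ?_
      ((prob_compl_eq_zero_iff (he (measurableSet_singleton u))).mpr hu)
    rintro ω hω rfl
    exact huB hω

/-- from static to dynamic Schrödinger bridges.  If `π̂` solves the
static problem with reference `e∗R` and `P̂ := π̂.bind κ` is the mixture of the
bridge measures `κ` under `π̂`, then `e∗P̂ = π̂`, `KL(P̂‖R) = KL(π̂‖e∗R)`, and `P̂`
minimizes `KL(·‖R)` among path measures with endpoint distribution in `Π(ρ0,ρT)`. -/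
theorem static_to_dynamic_SBP {n : ℕ} {Ω : Type*} [MeasurableSpace Ω] [StandardBorelSpace Ω]
    (ρ0 ρT : Measure (Fin n → ℝ))
    [IsProbabilityMeasure ρ0] [IsProbabilityMeasure ρT]
    (e : Ω → (Fin n → ℝ) × (Fin n → ℝ)) (he : Measurable e)
    (R : Measure Ω) [IsProbabilityMeasure R]
    (κ : ProbabilityTheory.Kernel ((Fin n → ℝ) × (Fin n → ℝ)) Ω)
    [ProbabilityTheory.IsMarkovKernel κ]
    -- κ disintegrates R over e
    (hdis : ∀ A : Set Ω, MeasurableSet A →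
      ∀ B : Set ((Fin n → ℝ) × (Fin n → ℝ)), MeasurableSet B →
        R (A ∩ e ⁻¹' B) = ∫⁻ u in B, κ u A ∂(R.map e))
    (hbridge : ∀ᵐ u ∂(R.map e), κ u (e ⁻¹' {u}) = 1)
    -- π̂ attains the infimum of KL(·‖e∗R) over Π(ρ0, ρT), and this infimum is finite
    (πhat : Measure ((Fin n → ℝ) × (Fin n → ℝ)))
    (hπmem : πhat ∈ Coupling ρ0 ρT)
    (hπmin : ∀ π ∈ Coupling ρ0 ρT, KL πhat (R.map e) ≤ KL π (R.map e))
    (hπfin : KL πhat (R.map e) ≠ ⊤)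
    -- P̂ is the mixture of the bridges κ(u) under π̂
    (Phat : Measure Ω) (hPhat : Phat = πhat.bind (fun u => κ u)) :
    Phat.map e = πhat ∧
    KL Phat R = KL πhat (R.map e) ∧
    ∀ P : Measure Ω, IsProbabilityMeasure P → P.map e ∈ Coupling ρ0 ρT →
      KL Phat R ≤ KL P R := by
  subst hPhat
  have : IsProbabilityMeasure πhat := hπmem.1
  have : IsProbabilityMeasure (R.map e) := Measure.isProbabilityMeasure_map he.aemeasurable
  have hac : πhat ≪ R.map e := by
    by_contra h
    exact hπfin (if_neg fun h' => h h'.1)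
  have hmap : (πhat.bind κ).map e = πhat := map_bind_of_ae_fiber he κ (hac.ae_le hbridge)
  have hR : (R.map e).bind κ = R := by
    ext A hA
    rw [Measure.bind_apply hA κ.aemeasurable]
    simpa using (hdis A hA Set.univ MeasurableSet.univ).symm
  have hmap_le : ∀ P : Measure Ω, IsProbabilityMeasure P → KL (P.map e) (R.map e) ≤ KL P R := by
    intro P _
    have : IsProbabilityMeasure (P.map e) := Measure.isProbabilityMeasure_map he.aemeasurable
    rw [KL_eq_klDiv, KL_eq_klDiv]
    exact_mod_cast InformationTheory.klDiv_map_le P R he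
  have hKL : KL (πhat.bind κ) R = KL πhat (R.map e) := by
    refine le_antisymm ?_ ?_
    · rw [KL_eq_klDiv, KL_eq_klDiv]
      have h := InformationTheory.klDiv_comp_right_le πhat (R.map e) κ
      rw [hR] at h
      exact_mod_cast h
    · simpa only [hmap] using hmap_le (πhat.bind κ) inferInstance
  exact ⟨hmap, hKL, fun P hP hPc => hKL.trans_le ((hπmin _ hPc).trans (hmap_le P hP))⟩
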